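/- arXiv:1903.00208 — 2 statements merged into one kernel-verified Lean document; each statement's English description precedes it below -/
import Mathlib

section
/- If G is a candidate and C is a shortest odd hole in G, then every C-major vertex has at least four neighbours in V(C). -/
/-!
Common definitions: holes, odd holes, C-major vertices, induced paths,
pyramids, jewels, candidates, x-gaps, gaps and normal sets.
A hole of length `n` is encoded as an injective map `f : ZMod n → V`
such that adjacency in `G` between vertices of the hole holds exactly
for consecutive indices (i.e. the hole is an induced cycle).
-/

variable {V : Type*}

/-- A hole: an induced cycle of length `n ≥ 4`. -/
def IsHole (G : SimpleGraph V) (n : ℕ) (f : ZMod n → V) : Prop :=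
  4 ≤ n ∧ Function.Injective f ∧
    ∀ i j : ZMod n, G.Adj (f i) (f j) ↔ (j = i + 1 ∨ i = j + 1)

/-- An odd hole. -/
def IsOddHole (G : SimpleGraph V) (n : ℕ) (f : ZMod n → V) : Prop :=
  IsHole G n f ∧ Odd n

/-- A shortest odd hole: an odd hole of minimum length among all odd holes. -/
def IsShortestOddHole (G : SimpleGraph V) (n : ℕ) (f : ZMod n → V) : Prop :=
  IsOddHole G n f ∧ ∀ (m : ℕ) (g : ZMod m → V), IsOddHole G m g → n ≤ m

/-- `G` has an odd hole. -/
def HasOddHole (G : SimpleGraph V) : Prop :=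
  ∃ (n : ℕ) (f : ZMod n → V), IsOddHole G n f

/-- A vertex `v` is `C`-major (for the hole given by `f`): `v` is not on the hole and
no three consecutive vertices of the hole contain all neighbours of `v` on the hole. -/
def IsCMajor (G : SimpleGraph V) {n : ℕ} (f : ZMod n → V) (v : V) : Prop :=
  v ∉ Set.range f ∧
    ∀ i : ZMod n, ∃ j : ZMod n, G.Adj v (f j) ∧ j ≠ i - 1 ∧ j ≠ i ∧ j ≠ i + 1

/-- An induced path of length `k`, encoded by its sequence of vertices:
adjacency holds exactly between consecutive vertices. -/
def IsInducedPathMap (G : SimpleGraph V) (k : ℕ) (p : Fin (k + 1) → V) : Prop :=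
  Function.Injective p ∧
    ∀ i j : Fin (k + 1), G.Adj (p i) (p j) ↔ (i.val + 1 = j.val ∨ j.val + 1 = i.val)

/-- A (not necessarily induced) path of length `k`, encoded by its sequence of vertices. -/
def IsPathMap (G : SimpleGraph V) (k : ℕ) (p : Fin (k + 1) → V) : Prop :=
  Function.Injective p ∧ ∀ i : Fin k, G.Adj (p i.castSucc) (p i.succ)

/-- A pyramid with apex `v0`, base `{v1, v2, v3}`, and paths `p1, p2, p3`
(of lengths `k1, k2, k3`) from `v0` to `v1, v2, v3` respectively. -/
def IsPyramid (G : SimpleGraph V) (v0 v1 v2 v3 : V) (k1 k2 k3 : ℕ)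
    (p1 : Fin (k1 + 1) → V) (p2 : Fin (k2 + 1) → V) (p3 : Fin (k3 + 1) → V) : Prop :=
  IsInducedPathMap G k1 p1 ∧ IsInducedPathMap G k2 p2 ∧ IsInducedPathMap G k3 p3 ∧
  p1 0 = v0 ∧ p2 0 = v0 ∧ p3 0 = v0 ∧
  p1 (Fin.last k1) = v1 ∧ p2 (Fin.last k2) = v2 ∧ p3 (Fin.last k3) = v3 ∧
  v1 ≠ v0 ∧ v2 ≠ v0 ∧ v3 ≠ v0 ∧
  G.Adj v1 v2 ∧ G.Adj v1 v3 ∧ G.Adj v2 v3 ∧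
  ((2 ≤ k1 ∧ 2 ≤ k2) ∨ (2 ≤ k1 ∧ 2 ≤ k3) ∨ (2 ≤ k2 ∧ 2 ≤ k3)) ∧
  (Set.range p1 ∩ Set.range p2 ⊆ {v0}) ∧
  (Set.range p1 ∩ Set.range p3 ⊆ {v0}) ∧
  (Set.range p2 ∩ Set.range p3 ⊆ {v0}) ∧
  (∀ u w : V, u ∈ Set.range p1 → w ∈ Set.range p2 → u ≠ v0 → w ≠ v0 →
    G.Adj u w → u = v1 ∧ w = v2) ∧
  (∀ u w : V, u ∈ Set.range p1 → w ∈ Set.range p3 → u ≠ v0 → w ≠ v0 →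
    G.Adj u w → u = v1 ∧ w = v3) ∧
  (∀ u w : V, u ∈ Set.range p2 → w ∈ Set.range p3 → u ≠ v0 → w ≠ v0 →
    G.Adj u w → u = v2 ∧ w = v3)

/-- `G` contains a pyramid. -/
def ContainsPyramid (G : SimpleGraph V) : Prop :=
  ∃ (v0 v1 v2 v3 : V) (k1 k2 k3 : ℕ) (p1 : Fin (k1 + 1) → V)
    (p2 : Fin (k2 + 1) → V) (p3 : Fin (k3 + 1) → V),
    IsPyramid G v0 v1 v2 v3 k1 k2 k3 p1 p2 p3

/-- A jewel on vertices `v1, …, v5` together with the path `p` (of length `k`)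
from `v1` to `v4`. -/
def IsJewel (G : SimpleGraph V) (v1 v2 v3 v4 v5 : V) (k : ℕ)
    (p : Fin (k + 1) → V) : Prop :=
  List.Pairwise Ne [v1, v2, v3, v4, v5] ∧
  G.Adj v1 v2 ∧ G.Adj v2 v3 ∧ G.Adj v3 v4 ∧ G.Adj v4 v5 ∧ G.Adj v5 v1 ∧
  ¬ G.Adj v1 v3 ∧ ¬ G.Adj v2 v4 ∧ ¬ G.Adj v1 v4 ∧
  IsInducedPathMap G k p ∧ p 0 = v1 ∧ p (Fin.last k) = v4 ∧
  ∀ i : Fin (k + 1), i ≠ 0 → i ≠ Fin.last k →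
    ¬ G.Adj v2 (p i) ∧ ¬ G.Adj v3 (p i) ∧ ¬ G.Adj v5 (p i)

/-- `G` contains a jewel. -/
def ContainsJewel (G : SimpleGraph V) : Prop :=
  ∃ (v1 v2 v3 v4 v5 : V) (k : ℕ) (p : Fin (k + 1) → V),
    IsJewel G v1 v2 v3 v4 v5 k p

/-- A candidate: a graph with no jewel, no pyramid, and no heavy-cleanable shortest
odd hole (a shortest odd hole is heavy-cleanable if some edge of it has the property
that every major vertex is adjacent to one of its ends). -/
def Candidate (G : SimpleGraph V) : Prop :=
  ¬ ContainsJewel G ∧ ¬ ContainsPyramid G ∧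
  ¬ ∃ (n : ℕ) (f : ZMod n → V) (i : ZMod n), IsShortestOddHole G n f ∧
      ∀ v : V, IsCMajor G f v → (G.Adj v (f i) ∨ G.Adj v (f (i + 1)))

/-- An `x`-gap of a hole `f : ZMod n → V`: an induced path of the hole, of length
`ℓ ≥ 2`, starting at index `a` and ending at index `a + ℓ`, whose ends are adjacent
to `x` and whose internal vertices are nonadjacent to `x`. (The condition `ℓ + 2 ≤ n`
says that the arc is an induced path of the hole.) -/
def IsXGap (G : SimpleGraph V) {n : ℕ} (f : ZMod n → V) (x : V) (a : ZMod n)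
    (ℓ : ℕ) : Prop :=
  2 ≤ ℓ ∧ ℓ + 2 ≤ n ∧ G.Adj x (f a) ∧ G.Adj x (f (a + (ℓ : ZMod n))) ∧
    ∀ t : ℕ, 0 < t → t < ℓ → ¬ G.Adj x (f (a + (t : ZMod n)))

/-- `ℓ` is the length of an `A`-gap of the cycle on `ZMod n` (with `A ⊆ ZMod n`):
either `A = ∅` and the gap is the whole cycle, or the gap runs from some `i ∈ A`
to `i + ℓ ∈ A` with no internal vertex in `A`. -/
def IsGapLength (n : ℕ) (A : Set (ZMod n)) (ℓ : ℕ) : Prop :=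
  (A = ∅ ∧ ℓ = n) ∨
  (2 ≤ ℓ ∧ ℓ ≤ n ∧ ∃ i ∈ A, (i + (ℓ : ZMod n)) ∈ A ∧
    ∀ t : ℕ, 0 < t → t < ℓ → (i + (t : ZMod n)) ∉ A)

/-- `A` is normal in the cycle on `ZMod n`: every `A`-gap has even length. -/
def NormalInCycle (n : ℕ) (A : Set (ZMod n)) : Prop :=
  ∀ ℓ : ℕ, IsGapLength n A ℓ → Even ℓ

/-- Casts into `ZMod n` of naturals less than `n` are consecutive exactly when
the naturals are, up to wrapping around. -/
theorem ZMod.natCast_eq_natCast_add_one_iff {n s t : ℕ} (hs : s < n) (ht : t < n) :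
    (t : ZMod n) = (s : ZMod n) + 1 ↔ t = s + 1 ∨ (t = 0 ∧ s + 1 = n) := by
  rw [← Nat.cast_succ, ZMod.natCast_eq_natCast_iff', Nat.mod_eq_of_lt ht]
  rcases Nat.lt_or_ge (s + 1) n with h | h
  · rw [Nat.mod_eq_of_lt h]
    omega
  · have h' : s + 1 = n := by omega
    rw [Nat.succ_eq_add_one, h', Nat.mod_self]
    omega

/-- `F 0, …, F (n - 1)` are the vertices of an induced cycle, in cyclic order. -/
def IsCycleSeq {V : Type*} (G : SimpleGraph V) (n : ℕ) (F : ℕ → V) : Prop :=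
  (∀ s t, s < n → t < n → F s = F t → s = t) ∧
    ∀ s t, s < n → t < n → (G.Adj (F s) (F t) ↔
      s + 1 = t ∨ t + 1 = s ∨ (s = 0 ∧ t + 1 = n) ∨ (t = 0 ∧ s + 1 = n))

theorem IsHole.isCycleSeq {V : Type*} {G : SimpleGraph V} {n : ℕ} {f : ZMod n → V}
    (h : IsHole G n f) (x : ZMod n) : IsCycleSeq G n fun t => f (x + t) := by
  obtain ⟨-, hinj, hadj⟩ := h
  refine ⟨fun s t hs ht hst => ?_, fun s t hs ht => ?_⟩
  · have := add_left_cancel (hinj hst)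
    rwa [ZMod.natCast_eq_natCast_iff', Nat.mod_eq_of_lt hs, Nat.mod_eq_of_lt ht] at this
  · rw [hadj, add_assoc, add_assoc, add_right_inj, add_right_inj,
      ZMod.natCast_eq_natCast_add_one_iff hs ht, ZMod.natCast_eq_natCast_add_one_iff ht hs]
    omega

/-- A vertex adjacent to the ends of an arc of a cycle, and to nothing between them,
closes the arc to a hole. -/
theorem IsCycleSeq.exists_isHole {V : Type*} {G : SimpleGraph V} {n l : ℕ} {F : ℕ → V} {v : V}
    (hF : IsCycleSeq G n F) (hl : 2 ≤ l) (hln : l + 2 ≤ n) (hv : ∀ t, v ≠ F t)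
    (hN : ∀ t ≤ l, G.Adj v (F t) ↔ t = 0 ∨ t = l) :
    ∃ g : ZMod (l + 2) → V, IsHole G (l + 2) g := by
  obtain ⟨hinj, hadj⟩ := hF
  refine ⟨fun i => if i.val ≤ l then F i.val else v, by omega, fun i j hij => ?_, fun i j => ?_⟩
  · apply ZMod.val_injective
    have hi := i.val_lt
    have hj := j.val_lt
    dsimp only at hij
    split_ifs at hij with h₁ h₂ h₂
    · exact hinj _ _ (by omega) (by omega) hij
    · exact absurd hij.symm (hv _)
    · exact absurd hij (hv _)
    · omega
  · have hi := i.val_lt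
    have hj := j.val_lt
    have e₁ := ZMod.natCast_eq_natCast_add_one_iff hi hj
    have e₂ := ZMod.natCast_eq_natCast_add_one_iff hj hi
    simp only [ZMod.natCast_zmod_val] at e₁ e₂
    rw [e₁, e₂]
    dsimp only
    split_ifs with h₁ h₂ h₂
    · rw [hadj _ _ (by omega) (by omega)]
      omega
    · rw [G.adj_comm, hN _ h₁]
      omega
    · rw [hN _ h₂]
      omega
    · simp only [SimpleGraph.irrefl, false_iff]
      omega

/-- A vertex whose neighbours on a cycle are two consecutive vertices and one further vertex,
adjacent to neither of them, gives a pyramid. -/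
theorem IsCycleSeq.containsPyramid {V : Type*} {G : SimpleGraph V} {b c : ℕ} {F : ℕ → V} {v : V}
    (hF : IsCycleSeq G (b + c + 1) F) (hb : 2 ≤ b) (hc : 2 ≤ c) (hv : ∀ t, v ≠ F t)
    (hN : ∀ t < b + c + 1, G.Adj v (F t) ↔ t = 0 ∨ t = b ∨ t = b + c) :
    ContainsPyramid G := by
  obtain ⟨hinj, hadj⟩ := hF
  have hvb : G.Adj v (F b) := (hN b (by omega)).2 (by omega)
  refine ⟨F b, F 0, F (b + c), v, b, c, 1, fun i => F (b - i), fun i => F (b + i),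
    ![F b, v], ⟨fun i j hij => ?_, fun i j => ?_⟩, ⟨fun i j hij => ?_, fun i j => ?_⟩,
    ⟨?_, ?_⟩, by simp, by simp, by simp, by simp, by simp, by simp, ?_, ?_, hv b, ?_, ?_, ?_,
    Or.inl ⟨hb, hc⟩, ?_, ?_, ?_, ?_, ?_, ?_⟩
  · have := hinj _ _ (by omega) (by omega) hij
    omega
  · rw [hadj _ _ (by omega) (by omega)]
    omega
  · have := hinj _ _ (by omega) (by omega) hij
    omega
  · rw [hadj _ _ (by omega) (by omega)]
    omega
  · intro i j hij
    fin_cases i <;> fin_cases j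
    · rfl
    · exact absurd hij.symm (hv b)
    · exact absurd hij (hv b)
    · rfl
  · intro i j
    fin_cases i <;> fin_cases j <;> simp [hvb, hvb.symm]
  · intro h
    have := hinj _ _ (by omega) (by omega) h
    omega
  · intro h
    have := hinj _ _ (by omega) (by omega) h
    omega
  · rw [hadj _ _ (by omega) (by omega)]
    omega
  · rw [G.adj_comm, hN _ (by omega)]
    omega
  · rw [G.adj_comm, hN _ (by omega)]
    omega
  · rintro _ ⟨⟨i, rfl⟩, ⟨j, hj⟩⟩
    have := hinj _ _ (by omega) (by omega) hj
    have hi : b - i.val = b := by omega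
    simp [hi]
  · rintro _ ⟨⟨i, rfl⟩, ⟨j, hj⟩⟩
    fin_cases j
    · exact hj.symm
    · exact absurd hj (hv _)
  · rintro _ ⟨⟨i, rfl⟩, ⟨j, hj⟩⟩
    fin_cases j
    · exact hj.symm
    · exact absurd hj (hv _)
  · rintro _ _ ⟨i, rfl⟩ ⟨j, rfl⟩ hi hj h
    have hi' : i.val ≠ 0 := fun h => hi (by simp [h])
    have hj' : j.val ≠ 0 := fun h => hj (by simp [h])
    rw [hadj _ _ (by omega) (by omega)] at h
    exact ⟨congrArg F (by omega), congrArg F (by omega)⟩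
  · rintro _ _ ⟨i, rfl⟩ ⟨j, rfl⟩ hi hj h
    have hi' : i.val ≠ 0 := fun h => hi (by simp [h])
    fin_cases j
    · exact absurd rfl hj
    · replace h := (hN _ (by omega)).1 h.symm
      exact ⟨congrArg F (by omega), rfl⟩
  · rintro _ _ ⟨i, rfl⟩ ⟨j, rfl⟩ hi hj h
    have hi' : i.val ≠ 0 := fun h => hi (by simp [h])
    fin_cases j
    · exact absurd rfl hj
    · replace h := (hN _ (by omega)).1 h.symm
      exact ⟨congrArg F (by omega), rfl⟩

/-- A set of at most three naturals containing `0` is `{0, p, q}` for some `p ≤ q`. -/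
theorem Finset.exists_zero_pair_of_card_le_three {S : Finset ℕ} (h0 : 0 ∈ S) (hS : S.card ≤ 3) :
    ∃ p q, p ≤ q ∧ ∀ t, t ∈ S ↔ t = 0 ∨ t = p ∨ t = q := by
  have hcard := Finset.card_erase_of_mem h0
  have hmem : ∀ t, t ∈ S ↔ t = 0 ∨ t ∈ S.erase 0 := fun t => by
    by_cases h : t = 0 <;> simp [h, h0]
  have : (S.erase 0).card = 0 ∨ (S.erase 0).card = 1 ∨ (S.erase 0).card = 2 := by omega
  rcases this with h | h | h
  · rw [Finset.card_eq_zero] at h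
    exact ⟨0, 0, le_rfl, fun t => by simp [hmem t, h]⟩
  · obtain ⟨p, hp⟩ := Finset.card_eq_one.1 h
    exact ⟨p, p, le_rfl, fun t => by simp [hmem t, hp]⟩
  · obtain ⟨p, q, -, hpq⟩ := Finset.card_eq_two.1 h
    rcases le_total p q with hle | hle
    · exact ⟨p, q, hle, fun t => by simp [hmem t, hpq]⟩
    · exact ⟨q, p, hle, fun t => by simp [hmem t, hpq, or_comm]⟩

/-- If `G` is a candidate and `C` is a shortest odd hole in `G`, then
every `C`-major vertex has at least four neighbours in `V(C)`. -/
theorem major_has_four_neighbours {V : Type*} [Fintype V] (G : SimpleGraph V)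
    (hG : Candidate G) (n : ℕ) (f : ZMod n → V) (hC : IsShortestOddHole G n f)
    (v : V) (hv : IsCMajor G f v) :
    4 ≤ {u : V | u ∈ Set.range f ∧ G.Adj v u}.ncard := by
  classical
  by_contra! hlt
  obtain ⟨⟨hhole, hodd⟩, hmin⟩ := hC
  obtain ⟨-, hpyr, -⟩ := hG
  obtain ⟨hvC, hmaj⟩ := hv
  have hn : 4 ≤ n := hhole.1
  have : NeZero n := ⟨by omega⟩
  have hne : ∀ j, v ≠ f j := fun j h => hvC ⟨j, h.symm⟩
  obtain ⟨x, hx, -⟩ := hmaj 0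
  let S : Finset ℕ := (Finset.range n).filter fun t => G.Adj v (f (x + t))
  have hS : S.card ≤ 3 := by
    refine le_trans ?_ (Nat.le_of_lt_succ hlt)
    rw [← Set.ncard_coe_finset]
    refine Set.ncard_le_ncard_of_injOn (fun t : ℕ => f (x + t)) ?_ ?_ (Set.toFinite _)
    · intro t ht
      exact ⟨⟨_, rfl⟩, (Finset.mem_filter.1 ht).2⟩
    · intro s hs t ht hst
      exact (hhole.isCycleSeq x).1 s t (Finset.mem_range.1 (Finset.mem_filter.1 hs).1)
        (Finset.mem_range.1 (Finset.mem_filter.1 ht).1) hst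
  obtain ⟨p, q, hpq, hmem⟩ := Finset.exists_zero_pair_of_card_le_three (S := S)
    (Finset.mem_filter.2 ⟨Finset.mem_range.2 (by omega), by simpa using hx⟩) hS
  have hN : ∀ t < n, G.Adj v (f (x + t)) ↔ t = 0 ∨ t = p ∨ t = q := fun t ht => by
    rw [← hmem, Finset.mem_filter, Finset.mem_range, and_iff_right ht]
  have hq : q < n := Finset.mem_range.1 (Finset.mem_filter.1 ((hmem q).2 (by simp))).1
  -- the neighbours of `v` as seen from `x + a`
  have hshift : ∀ a ≤ n, ∀ t < n, G.Adj v (f (x + (a : ZMod n) + t)) ↔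
      a + t = 0 ∨ a + t = p ∨ a + t = q ∨ a + t = n ∨ a + t = n + p ∨ a + t = n + q := by
    intro a ha t ht
    rw [add_assoc, ← Nat.cast_add]
    rcases Nat.lt_or_ge (a + t) n with h | h
    · rw [hN _ h]
      omega
    · obtain ⟨k, hk⟩ := Nat.exists_eq_add_of_le h
      rw [hk, Nat.cast_add, ZMod.natCast_self, zero_add, hN k (by omega)]
      omega
  -- majority, as seen from `x + a`
  have hmaj' : ∀ a : ℕ, ∃ t, 2 ≤ t ∧ t + 2 ≤ n ∧ G.Adj v (f (x + (a : ZMod n) + t)) := by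
    intro a
    obtain ⟨j, hj, h₁, h₂, h₃⟩ := hmaj (x + a)
    have hjt : j = x + a + ((j - (x + a)).val : ZMod n) := by simp
    have hlt := (j - (x + a)).val_lt
    generalize (j - (x + a)).val = t at hjt hlt
    refine ⟨t, ?_, ?_, hjt ▸ hj⟩
    · by_contra! h
      interval_cases t
      · exact h₂ (by simpa using hjt)
      · exact h₃ (by simpa using hjt)
    · by_contra! h
      apply h₁
      have ht : ((t + 1 : ℕ) : ZMod n) = 0 := by
        rw [show t + 1 = n by omega, ZMod.natCast_self]
      push_cast at ht
      rw [hjt, eq_neg_of_add_eq_zero_left ht, sub_eq_add_neg]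
  have hgap : ∀ a l : ℕ, 2 ≤ l → l + 2 < n → Odd l →
      (∀ t ≤ l, G.Adj v (f (x + (a : ZMod n) + t)) ↔ t = 0 ∨ t = l) → False := by
    intro a l hl hln hlo h
    obtain ⟨g, hg⟩ := (hhole.isCycleSeq (x + a)).exists_isHole hl hln.le (fun _ => hne _) h
    have := hmin _ g ⟨hg, by simpa [Nat.odd_add] using hlo⟩
    omega
  have hpyr' : ∀ a b : ℕ, 2 ≤ b → b + 3 ≤ n →
      (∀ t < n, G.Adj v (f (x + (a : ZMod n) + t)) ↔ t = 0 ∨ t = b ∨ t + 1 = n) → False := by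
    intro a b hb hbn h
    obtain ⟨c, rfl⟩ : ∃ c, n = b + c + 1 := ⟨n - 1 - b, by omega⟩
    refine hpyr ((hhole.isCycleSeq (x + a)).containsPyramid hb (by omega) (fun _ => hne _)
      fun t ht => ?_)
    rw [h t ht]
    omega
  have gap₁ : ¬ (2 ≤ p ∧ p + 2 < n ∧ p % 2 = 1) := fun ⟨h₁, h₂, h₃⟩ =>
    hgap 0 p h₁ h₂ (Nat.odd_iff.2 h₃) fun t ht => by
      rw [hshift 0 (by omega) t (by omega)]
      omega
  have gap₂ : ¬ (2 ≤ q - p ∧ q - p + 2 < n ∧ (q - p) % 2 = 1) := fun ⟨h₁, h₂, h₃⟩ =>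
    hgap p (q - p) h₁ h₂ (Nat.odd_iff.2 h₃) fun t ht => by
      rw [hshift p (by omega) t (by omega)]
      omega
  have gap₃ : ¬ (2 ≤ n - q ∧ n - q + 2 < n ∧ (n - q) % 2 = 1) := fun ⟨h₁, h₂, h₃⟩ =>
    hgap q (n - q) h₁ h₂ (Nat.odd_iff.2 h₃) fun t ht => by
      rw [hshift q (by omega) t (by omega)]
      omega
  have pyr₁ : ¬ (p = 1 ∧ 2 ≤ q - p ∧ q - p + 3 ≤ n) := fun ⟨_, h₁, h₂⟩ =>
    hpyr' p (q - p) h₁ h₂ fun t ht => by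
      rw [hshift p (by omega) t ht]
      omega
  have pyr₂ : ¬ (q = p + 1 ∧ 2 ≤ n - q ∧ n - q + 3 ≤ n) := fun ⟨_, h₁, h₂⟩ =>
    hpyr' q (n - q) h₁ h₂ fun t ht => by
      rw [hshift q (by omega) t ht]
      omega
  have pyr₃ : ¬ (q + 1 = n ∧ 2 ≤ p ∧ p + 3 ≤ n) := fun ⟨_, h₁, h₂⟩ =>
    hpyr' 0 p h₁ h₂ fun t ht => by
      rw [hshift 0 (by omega) t ht]
      omega
  obtain ⟨t₀, h₀, h₀', ht₀⟩ := hmaj' 0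
  obtain ⟨t₁, h₁, h₁', ht₁⟩ := hmaj' 1
  obtain ⟨t₂, h₂, h₂', ht₂⟩ := hmaj' (n - 1)
  rw [hshift _ (by omega) _ (by omega)] at ht₀ ht₁ ht₂
  rw [Nat.odd_iff] at hodd
  omega
end

section
/- Let G be a candidate, let C be a shortest odd hole in G, and let x, y be nonadjacent C-major vertices. Then every induced path of G between x and y whose interior is contained in V(C) has even length. -/
/-!
Common definitions: holes, odd holes, C-major vertices, induced paths,
pyramids, jewels, candidates, x-gaps, gaps and normal sets.
A hole of length `n` is encoded as an injective map `f : ZMod n → V`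
such that adjacency in `G` between vertices of the hole holds exactly
for consecutive indices (i.e. the hole is an induced cycle).
-/

variable {V : Type*}

/-- The properties used below of the (periodically unrolled) set of neighbours of a major vertex
on a shortest odd hole of length `n`. -/
structure IsMajorPattern (n : ℕ) (X : ℤ → Prop) : Prop where
  periodic : ∀ t, X (t + n) ↔ X t
  spread : ∀ i : ℤ, ∃ j, i + 2 ≤ j ∧ j ≤ i + n - 2 ∧ X j
  gap_even : ∀ p q, p < q → X p → X q → (∀ t, p < t → t < q → ¬ X t) → q = p + 1 ∨ Even (q - p)
  exists_ne_of_edge : ∀ p q, X p → X (p + 1) → X q → p + 1 < q → q < p + n →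
    ∃ t, p + 1 < t ∧ t < p + n ∧ t ≠ q ∧ X t
  exists_of_four : ∀ p, X p → X (p + 1) → X (p + 2) → X (p + 3) →
    ∃ t, p + 3 < t ∧ t < p + n ∧ X t

/-- The interval `[a, b]` contains a single element of `X`, namely `a`, and a single element
of `Y`, namely `b`. -/
def IsDirectedJump (X Y : ℤ → Prop) (a b : ℤ) : Prop :=
  a ≤ b ∧ X a ∧ Y b ∧ (∀ t, a < t → t ≤ b → ¬ X t) ∧ ∀ t, a ≤ t → t < b → ¬ Y t

/-- A directed jump in one of the two directions. -/
def IsJump (X Y : ℤ → Prop) (a b : ℤ) : Prop :=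
  IsDirectedJump X Y a b ∨ IsDirectedJump Y X a b

/-- The neighbour patterns of two nonadjacent major vertices on a shortest odd hole of
length `n`. -/
structure IsMajorPair (n : ℕ) (X Y : ℤ → Prop) : Prop where
  odd : Odd n
  left : IsMajorPattern n X
  right : IsMajorPattern n Y
  le_of_odd : ∀ a b a' b', IsJump X Y a b → IsJump X Y a' b' → b + 2 ≤ a' → b' + 2 ≤ a + n →
    Odd (b - a + (b' - a')) → n ≤ b - a + (b' - a') + 4

namespace IsMajorPattern

variable {n : ℕ} {X : ℤ → Prop}

theorem reflect (h : IsMajorPattern n X) : IsMajorPattern n fun t => X (-t) where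
  periodic t := by
    rw [← h.periodic (-(t + n))]
    simp
  spread i := by
    obtain ⟨j, h1, h2, h3⟩ := h.spread (-i - n)
    exact ⟨-j, by omega, by omega, by simpa using h3⟩
  gap_even p q hpq hp hq hno := by
    have := h.gap_even (-q) (-p) (by omega) hq hp fun t h1 h2 h3 =>
      hno (-t) (by omega) (by omega) (by simpa using h3)
    simp only [Int.even_iff] at *
    omega
  exists_ne_of_edge p q hp hp' hq h1 h2 := by
    obtain ⟨t, h3, h4, h5, h6⟩ := h.exists_ne_of_edge (-p - 1) (-q + n)
      (by convert hp' using 1; ring) (by convert hp using 1; ring) ((h.periodic _).2 hq)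
      (by omega) (by omega)
    refine ⟨-t + n, by omega, by omega, by omega, ?_⟩
    rw [← h.periodic]
    convert h6 using 1; ring
  exists_of_four p h0 h1 h2 h3 := by
    obtain ⟨t, h4, h5, h6⟩ := h.exists_of_four (-p - 3) (by convert h3 using 1; ring)
      (by convert h2 using 1; ring) (by convert h1 using 1; ring) (by convert h0 using 1; ring)
    refine ⟨-t + n, by omega, by omega, ?_⟩
    rw [← h.periodic]
    convert h6 using 1; ring

end IsMajorPattern

section Jump

variable {X Y : ℤ → Prop} {a b : ℤ}

theorem IsJump.swap (h : IsJump X Y a b) : IsJump Y X a b := Or.symm h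

theorem IsJump.le (h : IsJump X Y a b) : a ≤ b := h.elim (·.1) (·.1)

theorem IsDirectedJump.reflect (h : IsDirectedJump X Y a b) :
    IsDirectedJump (fun t => Y (-t)) (fun t => X (-t)) (-b) (-a) := by
  obtain ⟨h1, h2, h3, h4, h5⟩ := h
  exact ⟨by omega, by simpa using h3, by simpa using h2,
    fun t ht ht' => h5 (-t) (by omega) (by omega), fun t ht ht' => h4 (-t) (by omega) (by omega)⟩

theorem IsJump.reflect (h : IsJump X Y a b) :
    IsJump (fun t => X (-t)) (fun t => Y (-t)) (-b) (-a) :=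
  h.elim (fun h => .inr h.reflect) (fun h => .inl h.reflect)

theorem IsDirectedJump.translate {c : ℤ} (hX : ∀ t, X (t + c) ↔ X t) (hY : ∀ t, Y (t + c) ↔ Y t)
    (h : IsDirectedJump X Y a b) : IsDirectedJump X Y (a + c) (b + c) := by
  obtain ⟨h1, h2, h3, h4, h5⟩ := h
  refine ⟨by omega, (hX _).2 h2, (hY _).2 h3, fun t ht ht' hXt => ?_, fun t ht ht' hYt => ?_⟩
  · exact h4 (t - c) (by omega) (by omega) ((hX _).1 (by simpa using hXt))
  · exact h5 (t - c) (by omega) (by omega) ((hY _).1 (by simpa using hYt))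

theorem IsJump.translate {c : ℤ} (hX : ∀ t, X (t + c) ↔ X t) (hY : ∀ t, Y (t + c) ↔ Y t)
    (h : IsJump X Y a b) : IsJump X Y (a + c) (b + c) :=
  h.imp (.translate hX hY) (.translate hY hX)

/-- Among an element of `X` and an element of `Y` in an interval there is a jump. -/
theorem exists_isJump {i j lo hi : ℤ} (hi' : X i) (hj : Y j) (h1 : lo ≤ i) (h2 : i ≤ hi)
    (h3 : lo ≤ j) (h4 : j ≤ hi) : ∃ a b, lo ≤ a ∧ b ≤ hi ∧ IsJump X Y a b := by
  induction hd : (i - j).natAbs using Nat.strong_induction_on generalizing i j with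
  | _ d ih =>
    subst hd
    by_contra hno
    have key : ∀ t, (i ≤ t ∧ t ≤ j ∨ j ≤ t ∧ t ≤ i) → (X t → t = i) ∧ (Y t → t = j) := by
      intro t ht
      constructor
      · intro hX
        by_contra hne
        exact hno (ih _ (by omega) hX hj (by omega) (by omega) h3 h4 rfl)
      · intro hY
        by_contra hne
        exact hno (ih _ (by omega) hi' hY h1 h2 (by omega) (by omega) rfl)
    rcases le_total i j with h | h
    · exact hno ⟨i, j, h1, h4, .inl ⟨h, hi', hj, fun t h5 h6 h7 => by
        have := (key t (by omega)).1 h7; omega, fun t h5 h6 h7 => by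
        have := (key t (by omega)).2 h7; omega⟩⟩
    · exact hno ⟨j, i, h3, h2, .inr ⟨h, hj, hi', fun t h5 h6 h7 => by
        have := (key t (by omega)).2 h7; omega, fun t h5 h6 h7 => by
        have := (key t (by omega)).1 h7; omega⟩⟩

/-- A labelled point of a jump is one of its ends. -/
theorem IsJump.eq_or_eq {t : ℤ} (h : IsJump X Y a b) (ht : X t ∨ Y t) (h1 : a ≤ t) (h2 : t ≤ b) :
    t = a ∨ t = b := by
  by_contra hne
  rcases h with ⟨-, -, -, h4, h5⟩ | ⟨-, -, -, h4, h5⟩ <;> rcases ht with ht | ht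
  · exact h4 t (by omega) h2 ht
  · exact h5 t h1 (by omega) ht
  · exact h5 t h1 (by omega) ht
  · exact h4 t (by omega) h2 ht

theorem IsJump.label_left (h : IsJump X Y a b) : X a ∨ Y a := h.imp (·.2.1) (·.2.1)

theorem IsJump.label_right (h : IsJump X Y a b) : X b ∨ Y b := (h.imp (·.2.2.1) (·.2.2.1)).symm

/-- A jump contained in another jump is equal to it. -/
theorem IsJump.eq_of_subset {e f : ℤ} (h : IsJump X Y a b) (h' : IsJump X Y e f) (h1 : a ≤ e)
    (h2 : f ≤ b) : e = a ∧ f = b := by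
  rcases h with ⟨-, -, -, h4, h5⟩ | ⟨-, -, -, h4, h5⟩ <;>
    rcases h' with ⟨h0, h6, h7, -, -⟩ | ⟨h0, h6, h7, -, -⟩ <;>
    [have p := h4 e; have p := h4 f; have p := h4 f; have p := h4 e] <;>
    [have q := h5 f; have q := h5 e; have q := h5 e; have q := h5 f] <;>
    grind

end Jump

namespace IsMajorPair

variable {n : ℕ} {X Y : ℤ → Prop} {a b a' b' e f e' f' : ℤ}

theorem swap (h : IsMajorPair n X Y) : IsMajorPair n Y X where
  odd := h.odd
  left := h.right
  right := h.left
  le_of_odd a b a' b' hj hj' := h.le_of_odd a b a' b' hj.swap hj'.swap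

theorem reflect (h : IsMajorPair n X Y) :
    IsMajorPair n (fun t => X (-t)) (fun t => Y (-t)) where
  odd := h.odd
  left := h.left.reflect
  right := h.right.reflect
  le_of_odd a b a' b' hj hj' h1 h2 ho := by
    have := h.le_of_odd (-b') (-a') (-b) (-a) (by simpa using hj'.reflect)
      (by simpa using hj.reflect) (by omega) (by omega) (by convert ho using 1; ring)
    omega

theorem translate (h : IsMajorPair n X Y) (hj : IsJump X Y a b) : IsJump X Y (a + n) (b + n) :=
  hj.translate h.left.periodic h.right.periodic

theorem translate_neg (h : IsMajorPair n X Y) (hj : IsJump X Y a b) :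
    IsJump X Y (a - n) (b - n) :=
  hj.translate (c := -n) (fun t => by rw [← h.left.periodic]; simp)
    (fun t => by rw [← h.right.periodic]; simp)

theorem exists_left_of_directed (h : IsMajorPattern n X) (hn : Odd n)
    (hj : IsDirectedJump X Y a b) : ∃ j, b + 2 ≤ j ∧ j ≤ a + n - 2 ∧ X j := by
  by_contra hno
  push Not at hno
  obtain ⟨h1, h2, h3, h4, h5⟩ := hj
  obtain ⟨j, hj1, hj2, hj3⟩ := h.spread a
  have hjb : j = b + 1 := by
    by_contra hne
    by_cases hjb : j ≤ b
    · exact h4 j (by omega) hjb hj3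
    · exact hno j (by omega) hj2 hj3
  by_cases ha : X (a - 1)
  · obtain ⟨t, ht1, ht2, ht3, ht4⟩ := h.exists_ne_of_edge (a - 1) j ha (by simpa using h2) hj3
      (by omega) (by omega)
    by_cases htb : t ≤ b
    · exact h4 t (by omega) htb ht4
    · exact hno t (by omega) (by omega) ht4
  · have g1 := h.gap_even a j (by omega) h2 hj3 fun t ht ht' => h4 t (by omega) (by omega)
    have g2 := h.gap_even j (a + n) (by omega) hj3 ((h.periodic a).2 h2) fun t ht ht' hX => by
      by_cases htb : t = a + n - 1
      · apply ha
        rw [← h.periodic]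
        convert hX using 1; omega
      · exact hno t (by omega) (by omega) hX
    obtain ⟨m, rfl⟩ := hn
    simp only [Int.even_iff] at g1 g2
    push_cast at *
    omega

theorem exists_right_of_directed (h : IsMajorPattern n Y) (hn : Odd n)
    (hj : IsDirectedJump X Y a b) : ∃ j, b + 2 ≤ j ∧ j ≤ a + n - 2 ∧ Y j := by
  obtain ⟨j, h1, h2, h3⟩ := exists_left_of_directed h.reflect hn hj.reflect
  refine ⟨-j + n, by omega, by omega, (h.periodic _).2 h3⟩

/-- Every jump is disjoint from and not consecutive to some other jump. -/
theorem exists_isJump_apart (h : IsMajorPair n X Y) (hj : IsJump X Y a b) :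
    ∃ a' b', b + 2 ≤ a' ∧ b' + 2 ≤ a + n ∧ IsJump X Y a' b' := by
  obtain ⟨⟨i, h1, h2, h3⟩, j, h4, h5, h6⟩ : (∃ i, b + 2 ≤ i ∧ i ≤ a + n - 2 ∧ X i) ∧
      ∃ j, b + 2 ≤ j ∧ j ≤ a + n - 2 ∧ Y j := by
    rcases hj with hj | hj
    · exact ⟨exists_left_of_directed h.left h.odd hj, exists_right_of_directed h.right h.odd hj⟩
    · exact ⟨exists_right_of_directed h.left h.odd hj, exists_left_of_directed h.right h.odd hj⟩
  obtain ⟨c, d, h7, h8, h9⟩ := exists_isJump h3 h6 h1 h2 h4 h5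
  exact ⟨c, d, h7, by omega, h9⟩

/-- A directed odd jump and a jump apart from it have the same parity. -/
theorem odd_of_odd_of_directed (h : IsMajorPair n X Y) (hj : IsDirectedJump X Y a b)
    (hj' : IsJump X Y a' b') (h1 : b + 2 ≤ a') (h2 : b' + 2 ≤ a + n) (ho : Odd (b - a)) :
    Odd (b' - a') := by
  by_contra ho'
  have hle := h.le_of_odd a b a' b' (.inl hj) hj' h1 h2
    (ho.add_even (Int.not_odd_iff_even.1 ho'))
  have hle' := hj'.le
  obtain ⟨j1, Xa, Yb, nX, nY⟩ := hj
  obtain rfl : a' = b + 2 := by omega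
  obtain rfl : b' = a + n - 2 := by omega
  have hn := h.odd
  have gX := h.left.gap_even
  have gY := h.right.gap_even
  have Xn := (h.left.periodic a).2 Xa
  have Yn := (h.right.periodic b).2 Yb
  rw [Int.odd_iff] at ho ho'
  have hn2 : (n : ℤ) % 2 = 1 := by obtain ⟨m, rfl⟩ := hn; omega
  simp only [Int.even_iff] at gX gY
  have reverse : IsDirectedJump Y X (b + 2) (a + n - 2) → False := by
    rintro ⟨-, Yc, Xd, nYc, nXd⟩
    have Xb : X (b + 1) := by
      by_contra hXb
      have := gX a (a + n - 2) (by omega) Xa Xd fun t ht ht' hX => by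
        rcases lt_trichotomy t (b + 1) with h | h | h
        · exact nX t (by omega) (by omega) hX
        · exact hXb (h ▸ hX)
        · exact nXd t (by omega) (by omega) hX
      omega
    have := gX (b + 1) (a + n - 2) (by omega) Xb Xd fun t ht ht' hX =>
      nXd t (by omega) (by omega) hX
    have hlen : a + n - 2 = b + 2 := by omega
    by_cases Xl : X (a + n - 1)
    · obtain ⟨t, ht1, ht2, ht3⟩ := h.left.exists_of_four (b + 1) Xb
        (by convert Xd using 1; omega) (by convert Xl using 1; omega)
        (by convert Xn using 1; omega)
      refine nX (t - n) (by omega) (by omega) ?_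
      rw [← h.left.periodic]; simpa using ht3
    · obtain ⟨t, ht1, ht2, ht3, ht4⟩ := h.left.exists_ne_of_edge (b + 1) (a + n) Xb
        (by convert Xd using 1; omega) Xn (by omega) (by omega)
      by_cases htl : t = a + n - 1
      · exact Xl (htl ▸ ht4)
      · refine nX (t - n) (by omega) (by omega) ?_
        rw [← h.left.periodic]; simpa using ht4
  rcases hj' with ⟨-, Xc, Yd, nXc, nYd⟩ | hr
  · by_cases hlen : b + 2 = a + n - 2
    · exact reverse ⟨by omega, hlen ▸ Yd, hlen ▸ Xc, by grind, by grind⟩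
    by_cases Xl : X (a + n - 1)
    · have := gX (b + 2) (a + n - 1) (by omega) Xc Xl fun t ht ht' => nXc t (by omega) (by omega)
      omega
    by_cases Xb : X (b + 1)
    · obtain ⟨t, ht1, ht2, ht3, ht4⟩ := h.left.exists_ne_of_edge (b + 1) (a + n) Xb
        (by convert Xc using 1; omega) Xn (by omega) (by omega)
      by_cases htl : t = a + n - 1
      · exact Xl (htl ▸ ht4)
      by_cases htl' : t ≤ a + n - 2
      · exact nXc t (by omega) (by omega) ht4
      · refine nX (t - n) (by omega) (by omega) ?_
        rw [← h.left.periodic]; simpa using ht4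
    · have := gX a (b + 2) (by omega) Xa Xc fun t ht ht' hX => by
        by_cases htb : t = b + 1
        · exact Xb (htb ▸ hX)
        · exact nX t (by omega) (by omega) hX
      omega
  · exact reverse hr

theorem odd_of_odd (h : IsMajorPair n X Y) (hj : IsJump X Y a b)
    (hj' : IsJump X Y a' b') (h1 : b + 2 ≤ a') (h2 : b' + 2 ≤ a + n) (ho : Odd (b - a)) :
    Odd (b' - a') :=
  hj.elim (fun hj => h.odd_of_odd_of_directed hj hj' h1 h2 ho)
    (fun hj => h.swap.odd_of_odd_of_directed hj hj'.swap h1 h2 ho)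

/-- Two jumps apart from each other have the same parity. -/
theorem odd_iff_odd (h : IsMajorPair n X Y) (hj : IsJump X Y a b)
    (hj' : IsJump X Y a' b') (h1 : b + 2 ≤ a') (h2 : b' + 2 ≤ a + n) :
    Odd (b - a) ↔ Odd (b' - a') := by
  refine ⟨h.odd_of_odd hj hj' h1 h2, fun ho => ?_⟩
  have := h.odd_of_odd hj' (h.translate hj) h2 (by omega) ho
  simpa using this

end IsMajorPair

section EdgeCount

open Classical in
/-- The parity of the number of `i < t` such that `i` and `i + 1` both belong to `X`. -/
noncomputable def edgeCount (X : ℤ → Prop) (t : ℕ) : ZMod 2 :=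
  ∑ i ∈ Finset.range t, if X i ∧ X (i + 1) then 1 else 0

variable {X : ℤ → Prop} {n : ℕ}

theorem edgeCount_succ_of_edge {t : ℕ} (h : X t) (h' : X (t + 1)) :
    edgeCount X (t + 1) = edgeCount X t + 1 := by
  rw [edgeCount, Finset.sum_range_succ, if_pos ⟨h, h'⟩, edgeCount]

theorem edgeCount_eq_of_no_edge {p q : ℕ} (hpq : p ≤ q)
    (h : ∀ i : ℕ, p ≤ i → i < q → ¬ (X i ∧ X (i + 1))) : edgeCount X q = edgeCount X p := by
  induction q, hpq using Nat.le_induction with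
  | base => rfl
  | succ q hpq ih =>
    rw [← ih fun i h1 h2 => h i h1 (by omega), edgeCount, Finset.sum_range_succ,
      if_neg (h q hpq (by omega)), add_zero, edgeCount]

theorem edgeCount_add (h : ∀ t, X (t + n) ↔ X t) (t : ℕ) :
    edgeCount X (n + t) = edgeCount X n + edgeCount X t := by
  rw [edgeCount, Finset.sum_range_add]
  congr 1
  refine Finset.sum_congr rfl fun i _ => ?_
  have h1 : X ((n + i : ℕ) : ℤ) ↔ X i := by rw [← h i]; push_cast; rw [add_comm]
  have h2 : X (((n + i : ℕ) : ℤ) + 1) ↔ X (i + 1) := by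
    rw [← h (i + 1)]; push_cast; rw [show (n : ℤ) + i + 1 = i + 1 + n by ring]
  classical
  exact if_congr (and_congr h1 h2) rfl rfl

/-- A function which agrees on consecutive elements of a set agrees on all its elements. -/
theorem eq_of_consecutive {α : Type*} {S : ℕ → Prop} {g : ℕ → α}
    (hg : ∀ p q, p < q → S p → S q → (∀ r, p < r → r < q → ¬ S r) → g p = g q) {p q : ℕ}
    (hpq : p ≤ q) (hp : S p) (hq : S q) : g p = g q := by
  induction hd : q - p using Nat.strong_induction_on generalizing p q with
  | _ d ih =>
    subst hd
    rcases hpq.eq_or_lt with rfl | hlt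
    · rfl
    by_cases hr : ∃ r, p < r ∧ r < q ∧ S r
    · obtain ⟨r, h1, h2, h3⟩ := hr
      exact (ih _ (by omega) h1.le hp h3 rfl).trans (ih _ (by omega) h2.le h3 hq rfl)
    · push Not at hr
      exact hg p q hlt hp hq hr

theorem natCast_eq_add_of_gap (h : IsMajorPattern n X) {p q : ℕ} (hpq : p < q) (hp : X p)
    (hq : X q) (hno : ∀ r : ℕ, p < r → r < q → ¬ X r) :
    (p : ZMod 2) + edgeCount X p = q + edgeCount X q := by
  rcases h.gap_even p q (by omega) hp hq fun t h1 h2 => by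
    obtain ⟨r, rfl⟩ := Int.eq_ofNat_of_zero_le (show 0 ≤ t by omega)
    exact hno r (by omega) (by omega) with h1 | h1
  · obtain rfl : q = p + 1 := by omega
    rw [edgeCount_succ_of_edge hp (by exact_mod_cast hq)]
    push_cast
    have : (1 : ZMod 2) + 1 = 0 := rfl
    linear_combination -this
  · by_cases hq1 : q = p + 1
    · subst hq1
      simp at h1
    rw [edgeCount_eq_of_no_edge hpq.le]
    · congr 1
      rw [ZMod.natCast_eq_natCast_iff, Nat.ModEq]
      rw [Int.even_iff] at h1
      omega
    · rintro i h2 h3 ⟨h4, h5⟩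
      rcases h2.eq_or_lt with rfl | h2
      · exact hno (p + 1) (by omega) (by omega) (by exact_mod_cast h5)
      · exact hno i h2 h3 h4

/-- The neighbourhood of a major vertex spans an odd number of edges of the hole. -/
theorem IsMajorPattern.edgeCount_eq_one (h : IsMajorPattern n X) (hn : Odd n) :
    edgeCount X n = 1 := by
  obtain ⟨j, h1, -, h2⟩ := h.spread 0
  obtain ⟨r, rfl⟩ := Int.eq_ofNat_of_zero_le (show 0 ≤ j by omega)
  have hr : X ((n + r : ℕ) : ℤ) := by
    rw [← h.periodic] at h2; convert h2 using 1; push_cast; ring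
  have := eq_of_consecutive (S := fun i : ℕ => X i) (g := fun i => (i : ZMod 2) + edgeCount X i)
    (fun p q hpq hp hq hno => natCast_eq_add_of_gap h hpq hp hq hno)
    (p := r) (q := n + r) (by omega) h2 hr
  simp only [edgeCount_add h.periodic, Nat.cast_add] at this
  have hn' : (n : ZMod 2) = 1 := ZMod.natCast_eq_one_iff_odd.2 hn
  have h11 : (1 : ZMod 2) + 1 = 0 := rfl
  rw [hn'] at this
  linear_combination -this - h11

end EdgeCount

namespace IsMajorPair

variable {n : ℕ} {X Y : ℤ → Prop} {a b a' b' e f e' f' : ℤ}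

theorem exists_even_jump (h : IsMajorPair n X Y) : ∃ a b, IsJump X Y a b ∧ Even (b - a) := by
  classical
  by_contra hno
  push Not at hno
  have disj : ∀ t, X t → ¬ Y t := fun t hX hY => by
    simpa using hno t t (.inl ⟨le_rfl, hX, hY, by grind, by grind⟩)
  have h11 : (1 : ZMod 2) + 1 = 0 := rfl
  have hn' : (n : ZMod 2) = 1 := ZMod.natCast_eq_one_iff_odd.2 h.odd
  obtain ⟨j, h1, -, h2⟩ := h.left.spread 0
  obtain ⟨r, rfl⟩ := Int.eq_ofNat_of_zero_le (show 0 ≤ j by omega)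
  have hr : X ((n + r : ℕ) : ℤ) := by
    have h3 := h2
    rw [← h.left.periodic] at h3; convert h3 using 1; push_cast; ring
  have mixed : ∀ p q : ℕ, p < q → IsJump X Y p q →
      (p : ZMod 2) + edgeCount X p + edgeCount Y p + 1 = q + edgeCount X q + edgeCount Y q := by
    intro p q hpq hj
    have ho := hno p q hj
    rw [edgeCount_eq_of_no_edge hpq.le, edgeCount_eq_of_no_edge hpq.le]
    · have : (q : ZMod 2) = ((p + 1 : ℕ) : ZMod 2) := by
        rw [ZMod.natCast_eq_natCast_iff, Nat.ModEq]
        rw [Int.even_iff] at ho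
        omega
      rw [this]
      push_cast
      ring
    all_goals
      rintro i h3 h4 ⟨h5, h6⟩
      rcases hj with ⟨-, h7, h8, h9, h10⟩ | ⟨-, h7, h8, h9, h10⟩
      · first
        | exact h9 (i + 1) (by omega) (by omega) h6
        | exact h10 i (by omega) (by omega) h5
      · first
        | exact h9 (i + 1) (by omega) (by omega) h6
        | exact h10 i (by omega) (by omega) h5
  have noEdge : ∀ {Z : ℤ → Prop} {p q : ℕ}, p < q → ¬ Z p → ¬ Z q →
      (∀ r : ℕ, p < r → r < q → ¬ Z r) → edgeCount Z q = edgeCount Z p := by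
    intro Z p q hpq hp hq hr
    refine edgeCount_eq_of_no_edge hpq.le ?_
    rintro i h3 h4 ⟨h5, -⟩
    rcases h3.eq_or_lt with rfl | h3
    · exact hp h5
    · exact hr i h3 h4 h5
  have := eq_of_consecutive (S := fun i : ℕ => X i ∨ Y i)
    (g := fun i : ℕ => (i : ZMod 2) + edgeCount X i + edgeCount Y i + if Y i then 1 else 0)
    (fun p q hpq hp hq hr => ?_) (p := r) (q := n + r) (by omega) (.inl h2) (.inl hr)
  · simp only [if_neg (disj _ h2), if_neg (disj _ hr)] at this
    simp only [edgeCount_add h.left.periodic, edgeCount_add h.right.periodic, Nat.cast_add, h.left.edgeCount_eq_one h.odd,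
      h.right.edgeCount_eq_one h.odd, hn'] at this
    have h10 : (1 : ZMod 2) = 0 := by linear_combination - this - h11
    exact one_ne_zero h10
  · have between : ∀ t : ℤ, p < t → t < q → ¬ X t ∧ ¬ Y t := fun t h3 h4 => by
      obtain ⟨s, rfl⟩ := Int.eq_ofNat_of_zero_le (show 0 ≤ t by omega)
      exact not_or.1 (hr s (by omega) (by omega))
    have directed : ∀ {Z W : ℤ → Prop}, Z p → W q → ¬ W p → ¬ Z q →
        (∀ t : ℤ, p < t → t < q → ¬ Z t ∧ ¬ W t) → IsDirectedJump Z W p q := by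
      intro Z W h3 h4 h5 h6 h7
      refine ⟨by omega, h3, h4, fun t h8 h9 => ?_, fun t h8 h9 => ?_⟩
      · rcases h9.eq_or_lt with rfl | h9
        · exact h6
        · exact (h7 t h8 h9).1
      · rcases h8.eq_or_lt with rfl | h8
        · exact h5
        · exact (h7 t h8 h9).2
    rcases hp with hp | hp <;> rcases hq with hq | hq
    · have e1 := natCast_eq_add_of_gap h.left hpq hp hq fun r h3 h4 h5 => hr r h3 h4 (.inl h5)
      have e2 := noEdge hpq (disj _ hp) (disj _ hq) fun r h3 h4 h5 => hr r h3 h4 (.inr h5)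
      simp only [if_neg (disj _ hp), if_neg (disj _ hq), e1, e2]
    · have := mixed p q hpq (.inl (directed hp hq (disj _ hp) (fun hX => disj _ hX hq) between))
      simp only [if_neg (disj _ hp), if_pos hq]
      linear_combination this - h11
    · have := mixed p q hpq (.inr (directed hp hq (fun hX => disj _ hX hp) (disj _ hq)
        fun t h3 h4 => (between t h3 h4).symm))
      simp only [if_neg (disj _ hq), if_pos hp]
      linear_combination this
    · have e1 := natCast_eq_add_of_gap h.right hpq hp hq fun r h3 h4 h5 => hr r h3 h4 (.inr h5)
      have e2 := noEdge (Z := X) hpq (fun hX => disj _ hX hp) (fun hX => disj _ hX hq)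
        fun r h3 h4 h5 => hr r h3 h4 (.inl h5)
      simp only [if_pos hp, if_pos hq, e2]
      linear_combination e1

/-- An even jump starting in a given period fits between two odd jumps which are apart. -/
theorem even_jump_position (h : IsMajorPair n X Y) (hA : IsJump X Y a b) (hA' : IsJump X Y a' b')
    (h1 : b + 2 ≤ a') (h2 : b' + 2 ≤ a + n) (ho : Odd (b - a)) (ho' : Odd (b' - a'))
    (hE : IsJump X Y e f) (he : Even (f - e)) (h3 : a ≤ e) (h4 : e < a + n) :
    ((e = b ∨ e = b + 1) ∧ (f = a' - 1 ∨ f = a')) ∨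
      ((e = b' ∨ e = b' + 1) ∧ (f = a + n - 1 ∨ f = a + n)) := by
  have apart : ∀ c d, IsJump X Y c d → Odd (d - c) → ¬ (d + 2 ≤ e ∧ f + 2 ≤ c + n) :=
    fun c d hj ho h5 => Int.not_odd_iff_even.2 he ((h.odd_iff_odd hj hE h5.1 h5.2).1 ho)
  have apart1 := apart a b hA ho
  have apart2 := apart a' b' hA' ho'
  have apart3 := apart (a' - n) (b' - n) (h.translate_neg hA') (by simpa using ho')
  have end1 := hE.eq_or_eq hA.label_right
  have end2 := hE.eq_or_eq hA'.label_left
  have end3 := hE.eq_or_eq (h.translate hA).label_left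
  have end4 := hE.eq_or_eq hA'.label_right
  have sub1 := hA.eq_of_subset hE
  have sub2 := hA'.eq_of_subset hE
  have l1 := hA.le
  have l2 := hA'.le
  have l3 := hE.le
  rw [Int.odd_iff] at ho ho'
  rw [Int.even_iff] at he
  omega

end IsMajorPair

namespace IsMajorPair

variable {n : ℕ} {X Y : ℤ → Prop} {a b a' b' e f e' f' : ℤ}

theorem false_of_directed_of_left_aligned (h : IsMajorPair n X Y) (hA : IsJump X Y a b)
    (hA' : IsDirectedJump X Y a' b') (h1 : b + 2 ≤ a') (h2 : b' + 2 ≤ a + n)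
    (ho : Odd (b - a)) (ho' : Odd (b' - a'))
    (hE : IsJump X Y b (a' - 1)) (he : Even (a' - 1 - b))
    (hE' : IsJump X Y e' f') (he' : Even (f' - e'))
    (h3 : e' = b' ∨ e' = b' + 1) (h4 : f' = a + n - 1 ∨ f' = a + n) : False := by
  obtain ⟨l1, Xa', Yb', nX', nY'⟩ := hA'
  have gX := h.left.gap_even
  have gY := h.right.gap_even
  have pX : ∀ t, X (t - n) ↔ X t := fun t => by rw [← h.left.periodic]; simp
  have pY : ∀ t, Y (t - n) ↔ Y t := fun t => by rw [← h.right.periodic]; simp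
  have hn : (n : ℤ) % 2 = 1 := by obtain ⟨m, hm⟩ := h.odd; omega
  rw [Int.odd_iff] at ho ho'
  rw [Int.even_iff] at he he'
  simp only [Int.even_iff] at gX gY
  rcases hE with ⟨-, Xb, -, nXE, -⟩ | ⟨lE, Yb, Xf, nYE, nXE⟩
  · have := gX b a' (by omega) Xb Xa' fun t h5 h6 => nXE t h5 (by omega)
    omega
  rcases hA with ⟨l2, Xa, -, nXA, nYA⟩ | ⟨l2, -, -, nYA, -⟩
  swap
  · exact nYA b (by omega) le_rfl Yb
  have gapY : b' = b + 1 ∨ (b' - b) % 2 = 0 := gY b b' (by omega) Yb Yb' fun t h5 h6 => by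
    by_cases h7 : t ≤ a' - 1
    · exact nYE t h5 h7
    · exact nY' t (by omega) h6
  have Ybn := (h.right.periodic b).2 Yb
  -- The case of a jump between the two odd jumps, directed from `Y` to `X`.
  have trimmed : e' = b' + 1 → f' = a + n - 1 → IsDirectedJump Y X e' f' → False := by
    rintro rfl rfl ⟨l3, -, Xf', -, nXE'⟩
    have g1 := gX a' (a + n - 1) (by omega) Xa' Xf' fun t h5 h6 => by
      by_cases h7 : t ≤ b'
      · exact nX' t h5 h7
      · exact nXE' t (by omega) h6
    have g2 := gX a (a' - 1) (by omega) Xa Xf fun t h5 h6 => by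
      by_cases h7 : t ≤ b
      · exact nXA t h5 h7
      · exact nXE t (by omega) h6
    omega
  have tail : ∀ t, a + n ≤ t → t < b + n → ¬ Y t := fun t h5 h6 h7 =>
    nYA (t - n) (by omega) (by omega) ((pY t).2 h7)
  rcases h3 with rfl | rfl <;> rcases h4 with rfl | rfl
  · omega
  · rcases hE' with ⟨-, Xe', -⟩ | ⟨-, -, -, nYE', -⟩
    · exact nX' e' (by omega) le_rfl Xe'
    · have := gY e' (b + n) (by omega) Yb' Ybn fun t h5 h6 => by
        by_cases h7 : t ≤ a + n
        · exact nYE' t h5 h7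
        · exact tail t (by omega) h6
      omega
  · rcases hE' with ⟨l3, Xe', Yf', nXE', nYE'⟩ | hE'
    · by_cases hs : b' + 1 = a + n - 1
      · refine trimmed rfl rfl ⟨l3, ?_, ?_, ?_, ?_⟩
        · rw [hs]; exact Yf'
        · rw [← hs]; exact Xe'
        all_goals intros; omega
      · have g1 := gY b' (a + n - 1) (by omega) Yb' Yf' fun t h5 h6 =>
          nYE' t (by omega) h6
        have g2 := gY (a + n - 1) (b + n) (by omega) Yf' Ybn fun t h5 h6 =>
          tail t (by omega) h6
        omega
    · exact trimmed rfl rfl hE'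
  · omega

theorem false_of_left_aligned (h : IsMajorPair n X Y) (hA : IsJump X Y a b)
    (hA' : IsJump X Y a' b') (h1 : b + 2 ≤ a') (h2 : b' + 2 ≤ a + n)
    (ho : Odd (b - a)) (ho' : Odd (b' - a'))
    (hE : IsJump X Y b (a' - 1)) (he : Even (a' - 1 - b))
    (hE' : IsJump X Y e' f') (he' : Even (f' - e'))
    (h3 : e' = b' ∨ e' = b' + 1) (h4 : f' = a + n - 1 ∨ f' = a + n) : False := by
  rcases hA' with hA' | hA'
  · exact h.false_of_directed_of_left_aligned hA hA' h1 h2 ho ho' hE he hE' he' h3 h4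
  · exact h.swap.false_of_directed_of_left_aligned hA.swap hA' h1 h2 ho ho' hE.swap he hE'.swap
      he' h3 h4

theorem false_of_right_aligned (h : IsMajorPair n X Y) (hA : IsJump X Y a b)
    (hA' : IsJump X Y a' b') (h1 : b + 2 ≤ a') (h2 : b' + 2 ≤ a + n)
    (ho : Odd (b - a)) (ho' : Odd (b' - a'))
    (hE : IsJump X Y (b + 1) a') (he : Even (a' - (b + 1)))
    (hE' : IsJump X Y e' f') (he' : Even (f' - e'))
    (h3 : e' = b' ∨ e' = b' + 1) (h4 : f' = a + n - 1 ∨ f' = a + n) : False :=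
  h.reflect.false_of_left_aligned hA'.reflect hA.reflect (by omega) (by omega)
    (by convert ho' using 1; ring) (by convert ho using 1; ring)
    (by convert hE.reflect using 1; ring) (by convert he using 1; ring)
    (h.reflect.translate hE'.reflect) (by convert he' using 1; ring) (by omega) (by omega)

/-- Two odd and two even jumps cannot alternate around the hole. -/
theorem false_of_alternating (h : IsMajorPair n X Y) (hA : IsJump X Y a b)
    (hA' : IsJump X Y a' b') (h1 : b + 2 ≤ a') (h2 : b' + 2 ≤ a + n)
    (ho : Odd (b - a)) (ho' : Odd (b' - a'))
    (hE : IsJump X Y e f) (he : Even (f - e)) (hE' : IsJump X Y e' f') (he' : Even (f' - e'))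
    (h3 : e = b ∨ e = b + 1) (h4 : f = a' - 1 ∨ f = a')
    (h5 : e' = b' ∨ e' = b' + 1) (h6 : f' = a + n - 1 ∨ f' = a + n) : False := by
  have hn : (n : ℤ) % 2 = 1 := by obtain ⟨m, hm⟩ := h.odd; omega
  have hoA : Odd (b + n - (a + n)) := by simpa using ho
  have heE : Even (f + n - (e + n)) := by simpa using he
  have cases : (e = b ∧ f = a' - 1) ∨ (e = b + 1 ∧ f = a') ∨ (e' = b' ∧ f' = a + n - 1) ∨
      (e' = b' + 1 ∧ f' = a + n) := by
    simp only [Int.odd_iff, Int.even_iff] at ho ho' he he'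
    omega
  rcases cases with ⟨rfl, rfl⟩ | ⟨rfl, rfl⟩ | ⟨rfl, rfl⟩ | ⟨rfl, rfl⟩
  · exact h.false_of_left_aligned hA hA' h1 h2 ho ho' hE he hE' he' h5 h6
  · exact h.false_of_right_aligned hA hA' h1 h2 ho ho' hE he hE' he' h5 h6
  · exact h.false_of_left_aligned hA' (h.translate hA) h2 (by omega) ho' hoA hE' he'
      (h.translate hE) heE (by omega) (by omega)
  · exact h.false_of_right_aligned hA' (h.translate hA) h2 (by omega) ho' hoA hE' he'
      (h.translate hE) heE (by omega) (by omega)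

/-- Every jump has even length. -/
theorem even_of_isJump (h : IsMajorPair n X Y) (hA : IsJump X Y a b) : Even (b - a) := by
  by_contra ho
  rw [Int.not_even_iff_odd] at ho
  obtain ⟨a', b', h1, h2, hA'⟩ := h.exists_isJump_apart hA
  have ho' := (h.odd_iff_odd hA hA' h1 h2).1 ho
  obtain ⟨e, f, h3, h4, hE, he⟩ : ∃ e f, a ≤ e ∧ e < a + n ∧ IsJump X Y e f ∧ Even (f - e) := by
    obtain ⟨e, f, hE, he⟩ := h.exists_even_jump
    have hn : (0 : ℤ) < n := by exact_mod_cast h.odd.pos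
    have pX : Function.Periodic X n := fun t => propext (h.left.periodic t)
    have pY : Function.Periodic Y n := fun t => propext (h.right.periodic t)
    have hd := Int.mul_ediv_add_emod (e - a) n
    have hd' := Int.emod_nonneg (e - a) hn.ne'
    have hd'' := Int.emod_lt_of_pos (e - a) hn
    refine ⟨e + -((e - a) / n) * n, f + -((e - a) / n) * n, ?_, ?_,
      hE.translate (fun t => iff_of_eq (pX.int_mul _ t)) (fun t => iff_of_eq (pY.int_mul _ t)), ?_⟩
    · linarith
    · linarith
    · simpa using he
  obtain ⟨e', f', h5, h6, hE'⟩ := h.exists_isJump_apart hE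
  have he' : Even (f' - e') := by
    rw [← Int.not_odd_iff_even] at he ⊢
    rwa [← h.odd_iff_odd hE hE' h5 h6]
  have lA := hA.le
  have lA' := hA'.le
  have lE := hE.le
  have lE' := hE'.le
  have he'n : Even (f' - n - (e' - n)) := by simpa using he'
  have pos := h.even_jump_position hA hA' h1 h2 ho ho' hE he h3 h4
  have pos' := h.even_jump_position hA hA' h1 h2 ho ho' hE' he' (by omega)
  have pos'' := h.even_jump_position hA hA' h1 h2 ho ho' (h.translate_neg hE') he'n
  by_cases h7 : e' < a + n
  · have pos' := pos' h7
    rcases pos with pos | pos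
    · exact h.false_of_alternating hA hA' h1 h2 ho ho' hE he hE' he' pos.1 pos.2
        (by omega) (by omega)
    · omega
  · have pos'' := pos'' (by omega) (by omega)
    rcases pos with pos | pos
    · omega
    · exact h.false_of_alternating hA hA' h1 h2 ho ho' (h.translate_neg hE') he'n hE he
        (by omega) (by omega) pos.1 pos.2

end IsMajorPair

section Holes

variable {V : Type*} {G : SimpleGraph V} {n : ℕ} {f : ZMod n → V}

theorem IsHole.apply_ne (h : IsHole G n f) {c d : ℤ} (h1 : c ≠ d) (h2 : c - d < n)
    (h3 : d - c < n) : f c ≠ f d := by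
  intro he
  have := (ZMod.intCast_eq_intCast_iff_dvd_sub _ _ _).1 (h.2.1 he)
  exact h1 (by linarith [Int.eq_zero_of_abs_lt_dvd this (by rw [abs_lt]; omega)])

theorem IsHole.adj_iff (h : IsHole G n f) {c d : ℤ} (h2 : c - d < n - 1)
    (h3 : d - c < n - 1) : G.Adj (f c) (f d) ↔ d = c + 1 ∨ c = d + 1 := by
  rw [h.2.2]
  have key : ∀ c d : ℤ, c - d < n - 1 → d - c < n - 1 →
      ((d : ZMod n) = c + 1 ↔ d = c + 1) := by
    intro c d h2 h3
    constructor
    · intro he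
      have he' : ((c + 1 : ℤ) : ZMod n) = (d : ℤ) := by rw [he]; push_cast; rfl
      have := (ZMod.intCast_eq_intCast_iff_dvd_sub _ _ _).1 he'
      linarith [Int.eq_zero_of_abs_lt_dvd this (by rw [abs_lt]; omega)]
    · rintro rfl
      push_cast; rfl
  exact or_congr (key c d h2 h3) (key d c h3 h2)

/-- A cyclic sequence with the adjacencies of a cycle is a hole. -/
theorem isHole_of_seq {m : ℕ} (hm : 4 ≤ m) (g : ℕ → V)
    (hne : ∀ i j, i < j → j < m → g i ≠ g j)
    (hadj : ∀ i j, i < j → j < m → (G.Adj (g i) (g j) ↔ j = i + 1 ∨ i = 0 ∧ j + 1 = m)) :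
    IsHole G m fun z => g z.val := by
  have : NeZero m := ⟨by omega⟩
  have : Fact (1 < m) := ⟨by omega⟩
  have succ_iff : ∀ i j : ZMod m, j = i + 1 ↔
      j.val = i.val + 1 ∨ j.val = 0 ∧ i.val + 1 = m := by
    intro i j
    rw [← (ZMod.val_injective m).eq_iff, ZMod.val_add, ZMod.val_one]
    have hi := ZMod.val_lt i
    have hj := ZMod.val_lt j
    rcases (show i.val + 1 < m ∨ i.val + 1 = m by omega) with h | h
    · rw [Nat.mod_eq_of_lt h]; omega
    · rw [h, Nat.mod_self]; omega
  refine ⟨hm, fun i j hij => ?_, fun i j => ?_⟩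
  · apply ZMod.val_injective
    by_contra hne'
    rcases lt_or_gt_of_ne hne' with h | h
    · exact hne _ _ h (ZMod.val_lt j) hij
    · exact hne _ _ h (ZMod.val_lt i) hij.symm
  · rw [succ_iff, succ_iff]
    have hi := ZMod.val_lt i
    have hj := ZMod.val_lt j
    rcases lt_trichotomy i.val j.val with h | h | h
    · rw [hadj _ _ h hj]; omega
    · simp only [h, SimpleGraph.irrefl, false_iff]; omega
    · rw [G.adj_comm, hadj _ _ h hi]; omega

theorem IsHole.isInducedPathMap (h : IsHole G n f) {k : ℕ} (hk : k + 2 ≤ n) (s σ : ℤ)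
    (hσ : σ = 1 ∨ σ = -1) :
    IsInducedPathMap G k fun i => f ((s + σ * (i.val : ℤ) : ℤ) : ZMod n) := by
  refine ⟨fun i j hij => ?_, fun i j => ?_⟩
  · by_contra hne
    have : i.val ≠ j.val := fun h => hne (Fin.ext h)
    exact h.apply_ne (by rcases hσ with rfl | rfl <;> omega)
      (by rcases hσ with rfl | rfl <;> omega) (by rcases hσ with rfl | rfl <;> omega) hij
  · simp only
    rw [h.adj_iff] <;> rcases hσ with rfl | rfl <;> omega

/-- A jump can be traversed from its end in `X` to its end in `Y`. -/
theorem IsJump.exists_arc {X Y : ℤ → Prop} {a b : ℤ} (h : IsJump X Y a b) :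
    ∃ (L : ℕ) (s σ : ℤ), b - a = L ∧ (σ = 1 ∨ σ = -1) ∧ ∀ i : ℕ, i ≤ L →
      a ≤ s + σ * i ∧ s + σ * i ≤ b ∧ (X (s + σ * i) ↔ i = 0) ∧ (Y (s + σ * i) ↔ i = L) := by
  obtain ⟨L, hL⟩ := Int.eq_ofNat_of_zero_le (show 0 ≤ b - a by have := h.le; omega)
  rcases h with ⟨-, h1, h2, h3, h4⟩ | ⟨-, h1, h2, h3, h4⟩
  · refine ⟨L, a, 1, hL, .inl rfl, fun i hi => ⟨by omega, by omega, ⟨fun h => ?_, ?_⟩,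
      ⟨fun h => ?_, ?_⟩⟩⟩
    · by_contra hne
      exact h3 _ (by omega) (by omega) h
    · rintro rfl; simpa using h1
    · by_contra hne
      exact h4 _ (by omega) (by omega) h
    · rintro rfl; convert h2 using 1; omega
  · refine ⟨L, b, -1, hL, .inr rfl, fun i hi => ⟨by omega, by omega, ⟨fun h => ?_, ?_⟩,
      ⟨fun h => ?_, ?_⟩⟩⟩
    · by_contra hne
      exact h4 _ (by omega) (by omega) h
    · rintro rfl; simpa using h2
    · by_contra hne
      exact h3 _ (by omega) (by omega) h
    · rintro rfl; convert h1 using 1; omega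

/-- Two jumps which are apart form a hole together with `x` and `y`. -/
theorem IsHole.exists_hole_of_jumps (h : IsHole G n f) {x y : V} (hx : x ∉ Set.range f)
    (hy : y ∉ Set.range f) (hne : x ≠ y) (hxy : ¬ G.Adj x y) {a b a' b' : ℤ}
    (hj : IsJump (fun t : ℤ => G.Adj x (f t)) (fun t : ℤ => G.Adj y (f t)) a b)
    (hj' : IsJump (fun t : ℤ => G.Adj x (f t)) (fun t : ℤ => G.Adj y (f t)) a' b')
    (h1 : b + 2 ≤ a') (h2 : b' + 2 ≤ a + n) :
    ∃ (m : ℕ) (g : ZMod m → V), IsHole G m g ∧ (m : ℤ) = b - a + (b' - a') + 4 := by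
  obtain ⟨L, s, σ, hL, hσ, hu⟩ := hj.exists_arc
  obtain ⟨L', s', σ', hL', hσ', hu'⟩ := hj'.swap.exists_arc
  let g : ℕ → V := fun i => if i ≤ L then f ((s + σ * (i : ℤ) : ℤ)) else if i = L + 1 then y else
    if i ≤ L + L' + 2 then f ((s' + σ' * ((i - (L + 2) : ℕ) : ℤ) : ℤ)) else x
  have gA : ∀ i, i ≤ L → g i = f ((s + σ * (i : ℤ) : ℤ)) := fun i hi => if_pos hi
  have gy : g (L + 1) = y := by simp [g]
  have gB : ∀ i, i ≤ L' → g (L + 2 + i) = f ((s' + σ' * (i : ℤ) : ℤ)) := fun i hi => by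
    simp only [g]
    rw [if_neg (by omega), if_neg (by omega), if_pos (by omega)]
    simp
  have gx : g (L + L' + 3) = x := by
    simp only [g]
    rw [if_neg (by omega), if_neg (by omega), if_neg (by omega)]
  have cases : ∀ i, i < L + L' + 4 → i ≤ L ∨ i = L + 1 ∨ (∃ r ≤ L', i = L + 2 + r) ∨
      i = L + L' + 3 := fun i hi => by
    by_cases h3 : L + 2 ≤ i ∧ i ≤ L + L' + 2
    · exact .inr (.inr (.inl ⟨i - (L + 2), by omega, by omega⟩))
    · omega
  have key : ∀ i j, i < j → j < L + L' + 4 → g i ≠ g j ∧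
      (G.Adj (g i) (g j) ↔ j = i + 1 ∨ i = 0 ∧ j + 1 = L + L' + 4) := by
    intro i j hij hj
    rcases cases i (by omega) with hi | rfl | ⟨r, hr, rfl⟩ | rfl
    · obtain ⟨i1, i2, i3, i4⟩ := hu i hi
      rcases cases j hj with hj | rfl | ⟨r, hr, rfl⟩ | rfl
      · obtain ⟨j1, j2, -⟩ := hu j hj
        rw [gA i hi, gA j hj]
        refine ⟨h.apply_ne ?_ ?_ ?_, ?_⟩
        · rcases hσ with rfl | rfl <;> omega
        · omega
        · omega
        · rw [h.adj_iff (by omega) (by omega)]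
          rcases hσ with rfl | rfl <;> omega
      · rw [gA i hi, gy]
        refine ⟨fun he => hy ⟨_, he⟩, ?_⟩
        rw [G.adj_comm, i4]; omega
      · obtain ⟨j1, j2, -⟩ := hu' r hr
        rw [gA i hi, gB r hr]
        refine ⟨h.apply_ne (by omega) (by omega) (by omega), ?_⟩
        rw [h.adj_iff (by omega) (by omega)]; omega
      · rw [gA i hi, gx]
        refine ⟨fun he => hx ⟨_, he⟩, ?_⟩
        rw [G.adj_comm, i3]; omega
    · rcases cases j hj with hj | rfl | ⟨r, hr, rfl⟩ | rfl
      · omega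
      · omega
      · obtain ⟨j1, j2, j3, j4⟩ := hu' r hr
        rw [gy, gB r hr]
        refine ⟨fun he => hy ⟨_, he.symm⟩, ?_⟩
        rw [j3]; omega
      · rw [gy, gx]
        refine ⟨hne.symm, ?_⟩
        rw [G.adj_comm]
        simp only [hxy, false_iff]; omega
    · obtain ⟨i1, i2, i3, i4⟩ := hu' r hr
      rcases cases j hj with hj | rfl | ⟨r', hr', rfl⟩ | rfl
      · omega
      · omega
      · obtain ⟨j1, j2, -⟩ := hu' r' hr'
        rw [gB r hr, gB r' hr']
        refine ⟨h.apply_ne ?_ ?_ ?_, ?_⟩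
        · rcases hσ' with rfl | rfl <;> omega
        · omega
        · omega
        · rw [h.adj_iff (by omega) (by omega)]
          rcases hσ' with rfl | rfl <;> omega
      · rw [gB r hr, gx]
        refine ⟨fun he => hx ⟨_, he⟩, ?_⟩
        rw [G.adj_comm, i4]; omega
    · omega
  exact ⟨L + L' + 4, _, isHole_of_seq (by omega) g (fun i j h3 h4 => (key i j h3 h4).1)
    (fun i j h3 h4 => (key i j h3 h4).2), by push_cast; omega⟩

/-- A gap between two neighbours of `x` forms a hole together with `x`. -/
theorem IsHole.exists_hole_of_gap (h : IsHole G n f) {x : V} (hx : x ∉ Set.range f) {p q : ℤ}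
    (hp : G.Adj x (f p)) (hq : G.Adj x (f q)) (hno : ∀ t : ℤ, p < t → t < q → ¬ G.Adj x (f t))
    (h1 : p + 2 ≤ q) (h2 : q + 2 ≤ p + n) :
    ∃ (m : ℕ) (g : ZMod m → V), IsHole G m g ∧ (m : ℤ) = q - p + 2 := by
  obtain ⟨L, hL⟩ := Int.eq_ofNat_of_zero_le (show 0 ≤ q - p by omega)
  let g : ℕ → V := fun i => if i ≤ L then f ((p + i : ℤ)) else x
  have key : ∀ i j, i < j → j < L + 2 → g i ≠ g j ∧
      (G.Adj (g i) (g j) ↔ j = i + 1 ∨ i = 0 ∧ j + 1 = L + 2) := by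
    intro i j hij hj
    have gi : g i = f ((p + i : ℤ)) := if_pos (by omega)
    by_cases hjL : j ≤ L
    · have gj : g j = f ((p + j : ℤ)) := if_pos hjL
      rw [gi, gj]
      refine ⟨h.apply_ne (by omega) (by omega) (by omega), ?_⟩
      rw [h.adj_iff (by omega) (by omega)]; omega
    · have gj : g j = x := if_neg hjL
      rw [gi, gj]
      refine ⟨fun he => hx ⟨_, he⟩, ?_⟩
      rw [G.adj_comm]
      constructor
      · intro hadj
        by_contra hne
        exact hno (p + i) (by omega) (by omega) hadj
      · rintro (h3 | h3)
        · convert hq using 3; omega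
        · convert hp using 3; omega
  exact ⟨L + 2, _, isHole_of_seq (by omega) g (fun i j h3 h4 => (key i j h3 h4).1)
    (fun i j h3 h4 => (key i j h3 h4).2), by push_cast; omega⟩

theorem IsHole.containsPyramid (h : IsHole G n f) {x : V} (hx : x ∉ Set.range f) {p q : ℤ}
    (hp : G.Adj x (f p)) (hp' : G.Adj x (f (p + 1 : ℤ))) (hq : G.Adj x (f q))
    (h1 : p + 3 ≤ q) (h2 : q + 2 ≤ p + n)
    (hno : ∀ t : ℤ, p + 1 < t → t < p + n → t ≠ q → ¬ G.Adj x (f t)) : ContainsPyramid G := by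
  obtain ⟨k, hk⟩ := Int.eq_ofNat_of_zero_le (show 0 ≤ q - p - 1 by omega)
  obtain ⟨l, hl⟩ := Int.eq_ofNat_of_zero_le (show 0 ≤ p + n - q by omega)
  have cast_p : ((q + 1 * (l : ℤ) : ℤ) : ZMod n) = (p : ℤ) := by
    rw [show q + 1 * (l : ℤ) = p + n by omega]; simp
  have hxf : ∀ c, x ≠ f c := fun c he => hx ⟨c, he.symm⟩
  have hpq : f p ≠ f q := h.apply_ne (by omega) (by omega) (by omega)
  have hpq' : f (p + 1 : ℤ) ≠ f q := h.apply_ne (by omega) (by omega) (by omega)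
  refine ⟨f q, x, f (p + 1 : ℤ), f p, 1, k, l, fun i => if i.val = 0 then f q else x,
    fun i => f ((q + -1 * (i.val : ℤ) : ℤ)), fun i => f ((q + 1 * (i.val : ℤ) : ℤ)), ?_,
    h.isInducedPathMap (by omega) _ _ (.inr rfl), h.isInducedPathMap (by omega) _ _ (.inl rfl),
    by simp, by simp, by simp, by simp, ?_, ?_, hxf _, hpq', hpq, hp', hp, ?_, ?_, ?_, ?_, ?_,
    ?_, ?_, ?_⟩
  · constructor
    · rw [Function.Injective]
      simp [Fin.forall_fin_two, hxf, (hxf _).symm]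
    · simp [Fin.forall_fin_two, hq, hq.symm]
  · simp only [Fin.val_last]; congr 2; omega
  · simp only [Fin.val_last]; rw [cast_p]
  · rw [h.adj_iff (by omega) (by omega)]; omega
  · right; right; omega
  · rintro _ ⟨⟨i, rfl⟩, j, hj⟩
    simp only at hj ⊢
    split_ifs with h0
    · rfl
    · rw [if_neg h0] at hj
      exact (hxf _ hj.symm).elim
  · rintro _ ⟨⟨i, rfl⟩, j, hj⟩
    simp only at hj ⊢
    split_ifs with h0
    · rfl
    · rw [if_neg h0] at hj
      exact (hxf _ hj.symm).elim
  · rintro _ ⟨⟨i, rfl⟩, j, hj⟩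
    simp only at hj
    by_cases hij : i.val = 0
    · simp [hij]
    · exact (h.apply_ne (by omega) (by omega) (by omega) hj).elim
  · rintro _ _ ⟨i, rfl⟩ ⟨j, rfl⟩ hu hw hadj
    simp only at *
    split_ifs at * with h0
    · exact (hu rfl).elim
    · refine ⟨rfl, ?_⟩
      by_cases hj : j.val = k
      · congr 2; omega
      · have hj0 : j.val ≠ 0 := fun hj0 => hw (by simp [hj0])
        exact (hno _ (by omega) (by omega) (by omega) hadj).elim
  · rintro _ _ ⟨i, rfl⟩ ⟨j, rfl⟩ hu hw hadj
    simp only at *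
    split_ifs at * with h0
    · exact (hu rfl).elim
    · refine ⟨rfl, ?_⟩
      by_cases hj : j.val = l
      · rw [hj, cast_p]
      · have hj0 : j.val ≠ 0 := fun hj0 => hw (by simp [hj0])
        exact (hno _ (by omega) (by omega) (by omega) hadj).elim
  · rintro _ _ ⟨i, rfl⟩ ⟨j, rfl⟩ hu hw hadj
    simp only at *
    have hi0 : i.val ≠ 0 := fun hi0 => hu (by simp [hi0])
    have hj0 : j.val ≠ 0 := fun hj0 => hw (by simp [hj0])
    by_cases hi : i.val = k ∧ j.val = l
    · rw [hi.2, cast_p]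
      refine ⟨?_, rfl⟩
      congr 2; omega
    · rw [h.adj_iff (by omega) (by omega)] at hadj
      omega

theorem IsHole.containsJewel (h : IsHole G n f) (hn : 5 ≤ n) {x : V} (hx : x ∉ Set.range f)
    {p : ℤ} (h0 : G.Adj x (f p)) (h3 : G.Adj x (f (p + 3 : ℤ)))
    (hno : ∀ t : ℤ, p + 3 < t → t < p + n → ¬ G.Adj x (f t)) : ContainsJewel G := by
  obtain ⟨k, rfl⟩ := Nat.exists_eq_add_of_le' (show 3 ≤ n by omega)
  have cast_p : ∀ t : ℤ, ((t + ((k + 3 : ℕ) : ℤ) : ℤ) : ZMod (k + 3)) = t := fun t => by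
    rw [Int.cast_add, Int.cast_natCast, ZMod.natCast_self, add_zero]
  have hxf : ∀ c, f c ≠ x := fun c he => hx ⟨c, he⟩
  refine ⟨f p, f (p + 1 : ℤ), f (p + 2 : ℤ), f (p + 3 : ℤ), x, k,
    fun i => f ((p + -1 * (i.val : ℤ) : ℤ)), ?_, ?_, ?_, ?_, h3.symm, h0, ?_, ?_, ?_,
    h.isInducedPathMap (by omega) _ _ (.inr rfl), by simp, ?_, ?_⟩
  · simp only [List.pairwise_cons, List.mem_cons, List.not_mem_nil, or_false, forall_eq_or_imp,
      forall_eq, ne_eq, hxf, not_false_eq_true, and_true, IsEmpty.forall_iff, implies_true,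
      List.Pairwise.nil]
    refine ⟨⟨?_, ?_, ?_⟩, ⟨?_, ?_⟩, ?_⟩ <;> exact h.apply_ne (by omega) (by omega) (by omega)
  · rw [h.adj_iff (by omega) (by omega)]; omega
  · rw [h.adj_iff (by omega) (by omega)]; omega
  · rw [h.adj_iff (by omega) (by omega)]; omega
  · rw [h.adj_iff (by omega) (by omega)]; omega
  · rw [h.adj_iff (by omega) (by omega)]; omega
  · rw [h.adj_iff (by omega) (by omega)]; omega
  · simp only [Fin.val_last]
    rw [← cast_p]; congr 2; push_cast; omega
  · intro i hi hi'
    have hi0 : i.val ≠ 0 := fun h => hi (Fin.ext h)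
    have hik : i.val ≠ k := fun h => hi' (Fin.ext h)
    simp only
    rw [← cast_p (p + -1 * (i.val : ℤ))]
    refine ⟨?_, ?_, hno _ (by omega) (by omega)⟩
    · rw [h.adj_iff (by omega) (by omega)]; omega
    · rw [h.adj_iff (by omega) (by omega)]; omega

end Holes

section Major

variable {V : Type*} {G : SimpleGraph V} {n : ℕ} {f : ZMod n → V}

theorem IsCMajor.spread [NeZero n] {x : V} (hx : IsCMajor G f x) (i : ℤ) :
    ∃ j : ℤ, i + 2 ≤ j ∧ j ≤ i + n - 2 ∧ G.Adj x (f j) := by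
  obtain ⟨j, h1, h2, h3, h4⟩ := hx.2 i
  have hj : j = ((i + (j - i).val : ℤ) : ZMod n) := by
    push_cast
    rw [ZMod.natCast_zmod_val]; ring
  have hlt := ZMod.val_lt (j - (i : ZMod n))
  generalize (j - (i : ZMod n)).val = r at hj hlt
  have r0 : r ≠ 0 := by rintro rfl; exact h3 (by simpa using hj)
  have r1 : r ≠ 1 := by rintro rfl; exact h4 (by simpa using hj)
  have rn : r + 1 ≠ n := by
    intro hr
    apply h2
    rw [hj, show (i + r : ℤ) = i - 1 + n by omega]
    simp
  exact ⟨i + r, by omega, by omega, hj ▸ h1⟩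

theorem IsCMajor.isMajorPattern (hC : IsShortestOddHole G n f) (hJ : ¬ ContainsJewel G)
    (hP : ¬ ContainsPyramid G) {x : V} (hx : IsCMajor G f x) :
    IsMajorPattern n fun t : ℤ => G.Adj x (f t) := by
  obtain ⟨⟨hole, hodd⟩, hmin⟩ := hC
  have hn := hole.1
  have : NeZero n := ⟨by omega⟩
  have hn5 : 5 ≤ n := by obtain ⟨m, rfl⟩ := hodd; omega
  refine ⟨fun t => by simp, hx.spread, fun p q hpq hp hq hno => ?_,
    fun p q hp hp' hq h1 h2 => ?_, fun p h0 _ _ h3 => ?_⟩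
  · by_contra! hne
    obtain ⟨j, h1, h2, h3⟩ := hx.spread (p - 1)
    have hjq : q ≤ j := by
      by_contra hjq
      exact hno j (by omega) (by omega) h3
    obtain ⟨m, g, hg, hm⟩ := hole.exists_hole_of_gap hx.1 hp hq hno (by omega) (by omega)
    have := hmin m g ⟨hg, by
      rw [← Int.odd_coe_nat, hm, Int.odd_iff]
      have := hne.2
      rw [Int.even_iff] at this
      omega⟩
    omega
  · by_contra! hno
    obtain ⟨j, h3, h4, h5⟩ := hx.spread (p + 1)
    have hj : j = q := by
      by_contra hj
      exact hno j (by omega) (by omega) hj h5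
    obtain ⟨j', h3', h4', h5'⟩ := hx.spread p
    have hj' : j' = q := by
      by_contra hj'
      exact hno j' (by omega) (by omega) hj' h5'
    exact hP (hole.containsPyramid hx.1 hp hp' hq (by omega) (by omega) hno)
  · by_contra! hno
    exact hJ (hole.containsJewel hn5 hx.1 h0 h3 hno)

theorem IsShortestOddHole.isMajorPair (hC : IsShortestOddHole G n f) (hJ : ¬ ContainsJewel G)
    (hP : ¬ ContainsPyramid G) {x y : V} (hx : IsCMajor G f x) (hy : IsCMajor G f y)
    (hne : x ≠ y) (hxy : ¬ G.Adj x y) :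
    IsMajorPair n (fun t : ℤ => G.Adj x (f t)) (fun t : ℤ => G.Adj y (f t)) where
  odd := hC.1.2
  left := hx.isMajorPattern hC hJ hP
  right := hy.isMajorPattern hC hJ hP
  le_of_odd a b a' b' hj hj' h1 h2 ho := by
    obtain ⟨m, g, hg, hm⟩ := hC.1.1.exists_hole_of_jumps hx.1 hy.1 hne hxy hj hj' h1 h2
    have := hC.2 m g ⟨hg, by
      rw [← Int.odd_coe_nat, hm, Int.odd_iff]
      rw [Int.odd_iff] at ho
      omega⟩
    omega

/-- An induced path contained in a hole runs along the hole in a constant direction. -/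
theorem IsHole.exists_direction (h : IsHole G n f) {k : ℕ} {c : ℕ → ZMod n}
    (hinj : ∀ i j, i ≤ k → j ≤ k → c i = c j → i = j)
    (hadj : ∀ i, i < k → G.Adj (f (c i)) (f (c (i + 1)))) :
    ∃ s σ : ℤ, (σ = 1 ∨ σ = -1) ∧ ∀ i : ℕ, i ≤ k → c i = ((s + σ * i : ℤ) : ZMod n) := by
  obtain ⟨s, hs⟩ := ZMod.intCast_surjective (c 0)
  have step : ∀ i, i < k → c (i + 1) = c i + 1 ∨ c (i + 1) = c i - 1 := fun i hi =>
    ((h.2.2 _ _).1 (hadj i hi)).imp id fun h => by rw [h]; ring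
  rcases k.eq_zero_or_pos with rfl | hk
  · exact ⟨s, 1, .inl rfl, fun i hi => by simp [Nat.le_zero.1 hi, hs]⟩
  obtain ⟨σ, hσ, h1⟩ : ∃ σ : ℤ, (σ = 1 ∨ σ = -1) ∧ c 1 = c 0 + σ := by
    rcases step 0 hk with h1 | h1
    · exact ⟨1, .inl rfl, by simpa using h1⟩
    · exact ⟨-1, .inr rfl, by simpa [sub_eq_add_neg] using h1⟩
  have diff : ∀ i, i < k → c (i + 1) = c i + σ := by
    intro i
    induction i with
    | zero => intro _; exact h1
    | succ i ih =>
      intro hi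
      have e1 := ih (by omega)
      have hne : c (i + 1 + 1) ≠ c i := fun he => by
        have := hinj _ _ (by omega) (by omega) he; omega
      rcases hσ with rfl | rfl <;> rcases step (i + 1) hi with h2 | h2
      · simpa using h2
      · exact (hne (by rw [h2, e1]; simp)).elim
      · exact (hne (by rw [h2, e1]; simp)).elim
      · simpa [sub_eq_add_neg] using h2
  refine ⟨s, σ, hσ, fun i => ?_⟩
  induction i with
  | zero => intro _; simp [hs]
  | succ i ih =>
    intro hi
    rw [diff i (by omega), ih (by omega)]
    push_cast; ring

end Major

/-- Let `G` be a candidate, `C` a shortest odd hole in `G`, and `x, y`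
nonadjacent `C`-major vertices. Then every induced path of `G` between `x` and `y`
whose interior is contained in `V(C)` has even length. -/
theorem major_jump_even {V : Type*} [Fintype V] (G : SimpleGraph V)
    (hG : Candidate G) (n : ℕ) (f : ZMod n → V) (hC : IsShortestOddHole G n f)
    (x y : V) (hx : IsCMajor G f x) (hy : IsCMajor G f y)
    (hne : x ≠ y) (hxy : ¬ G.Adj x y)
    (k : ℕ) (p : Fin (k + 1) → V) (hp : IsInducedPathMap G k p)
    (hp0 : p 0 = x) (hpl : p (Fin.last k) = y)
    (hint : ∀ i : Fin (k + 1), i ≠ 0 → i ≠ Fin.last k → p i ∈ Set.range f) :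
    Even k := by
  obtain ⟨hJ, hP, -⟩ := hG
  have pair := hC.isMajorPair hJ hP hx hy hne hxy
  have hole := hC.1.1
  have hk0 : k ≠ 0 := by
    rintro rfl
    exact hne (hp0.symm.trans hpl)
  have hk1 : k ≠ 1 := by
    rintro rfl
    exact hxy (hp0 ▸ hpl ▸ (hp.2 0 (Fin.last 1)).2 (.inl rfl))
  have interior : ∀ i : ℕ, ∃ c : ZMod n, ∀ hi : i ≤ k - 2, f c = p ⟨i + 1, by omega⟩ := by
    intro i
    by_cases hi : i ≤ k - 2
    · obtain ⟨c, hc⟩ := hint ⟨i + 1, by omega⟩ (by simp [Fin.ext_iff])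
        (by simp only [ne_eq, Fin.ext_iff, Fin.val_last]; omega)
      exact ⟨c, fun _ => hc⟩
    · exact ⟨0, fun h => absurd h hi⟩
  choose c hc using interior
  obtain ⟨s, σ, hσ, hcs⟩ := hole.exists_direction (k := k - 2) (c := c)
    (fun i j hi hj hij => by
      have := hp.1 ((hc i hi).symm.trans ((congrArg f hij).trans (hc j hj)))
      simpa using this)
    (fun i hi => by
      rw [hc i (by omega), hc (i + 1) (by omega), hp.2]
      exact .inl rfl)
  have adjx : ∀ i : ℕ, i ≤ k - 2 → (G.Adj x (f ((s + σ * i : ℤ))) ↔ i = 0) := by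
    intro i hi
    rw [← hcs i hi, hc i hi, ← hp0, hp.2]
    simp only [Fin.val_zero]
    omega
  have adjy : ∀ i : ℕ, i ≤ k - 2 → (G.Adj y (f ((s + σ * i : ℤ))) ↔ i = k - 2) := by
    intro i hi
    rw [← hcs i hi, hc i hi, ← hpl, hp.2]
    simp only [Fin.val_last]
    omega
  rcases hσ with rfl | rfl
  · have jump : IsJump (fun t : ℤ => G.Adj x (f t)) (fun t : ℤ => G.Adj y (f t)) s
        (s + 1 * (k - 2 : ℕ)) := by
      refine .inl ⟨by omega, by simpa using (adjx 0 (by omega)).2 rfl,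
        (adjy _ le_rfl).2 rfl, fun t h1 h2 h3 => ?_, fun t h1 h2 h3 => ?_⟩
      all_goals
        obtain ⟨i, hi⟩ := Int.eq_ofNat_of_zero_le (show 0 ≤ t - s by omega)
        obtain rfl : t = s + 1 * i := by omega
      · have := (adjx i (by omega)).1 h3; omega
      · have := (adjy i (by omega)).1 h3; omega
    have := pair.even_of_isJump jump
    rw [Int.even_iff] at this
    rw [Nat.even_iff]
    omega
  · have jump : IsJump (fun t : ℤ => G.Adj x (f t)) (fun t : ℤ => G.Adj y (f t))
        (s + -1 * (k - 2 : ℕ)) s := by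
      refine .inr ⟨by omega, (adjy _ le_rfl).2 rfl, by simpa using (adjx 0 (by omega)).2 rfl,
        fun t h1 h2 h3 => ?_, fun t h1 h2 h3 => ?_⟩
      all_goals
        obtain ⟨i, hi⟩ := Int.eq_ofNat_of_zero_le (show 0 ≤ s - t by omega)
        obtain rfl : t = s + -1 * i := by omega
      · have := (adjy i (by omega)).1 h3; omega
      · have := (adjx i (by omega)).1 h3; omega
    have := pair.even_of_isJump jump
    rw [Int.even_iff] at this
    rw [Nat.even_iff]
    omega
end
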